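/- For real constants α, β, γ > 0 with α² = β² + γ², and nonnegative integers m, n with n ≤ m, the Weierstrass (Gaussian) smoothing of a product of Hermite polynomials satisfies: (e^{-x²/(2α²)}/(√(2π)α)) Σ_{s=0}^{n} (1/s!) C(m+n-2s, n-s) (γ/α)^{m+n-2s} H_{m+n-2s}(x/α)/(m+n-2s)! = ∫_{-∞}^{∞} (e^{-(x-x')²/(2β²)}/(√(2π)β)) (e^{-x'²/(2γ²)}/(√(2π)γ)) (H_m(x'/γ)/m!)(H_n(x'/γ)/n!) dx'. -/

import Mathlib

open Real MeasureTheory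

/-- Probabilists' Hermite polynomial `H_k(x) = (-1)^k e^{x²/2} dᵏ/dxᵏ e^{-x²/2}`. -/
noncomputable def H (k : ℕ) (x : ℝ) : ℝ :=
  (-1 : ℝ) ^ k * Real.exp (x ^ 2 / 2) * iteratedDeriv k (fun y => Real.exp (-y ^ 2 / 2)) x

open Polynomial in
/-- real Hermite polynomial -/
noncomputable def hr (k : ℕ) : Polynomial ℝ := (Polynomial.hermite k).map (Int.castRingHom ℝ)

lemma hr_succ (k : ℕ) : hr (k + 1) = Polynomial.X * hr k - Polynomial.derivative (hr k) := by
  simp [hr, Polynomial.hermite_succ, Polynomial.derivative_map]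

lemma hr_zero : hr 0 = 1 := by simp [hr]

lemma hr_deriv (k : ℕ) :
    Polynomial.derivative (hr (k + 1)) = ((k + 1 : ℕ) : Polynomial ℝ) * hr k := by
  induction k with
  | zero => simp [hr_succ, hr_zero]
  | succ k ih =>
    rw [hr_succ (k + 1)]
    simp only [Polynomial.derivative_sub, Polynomial.derivative_mul, Polynomial.derivative_X, ih,
      Polynomial.derivative_natCast]
    rw [hr_succ k]
    push_cast
    ring

lemma hr_deriv' (k : ℕ) :
    Polynomial.derivative (hr k) = (k : Polynomial ℝ) * hr (k - 1) := by
  cases k with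
  | zero => simp [hr_zero]
  | succ k => simpa using hr_deriv k

lemma H_eq (k : ℕ) (x : ℝ) : H k x = (hr k).eval x := by
  have h := Polynomial.hermite_eq_deriv_gaussian' k x
  rw [Polynomial.aeval_def, Polynomial.eval₂_eq_eval_map] at h
  have e : (fun y : ℝ => Real.exp (-y ^ 2 / 2)) = fun y => Real.exp (-(y ^ 2 / 2)) := by
    funext y; congr 1; ring
  rw [H, iteratedDeriv_eq_iterate, e]
  change _ = Polynomial.eval x ((Polynomial.hermite k).map (algebraMap ℤ ℝ))
  rw [h]
  ring

lemma hr_mul (n : ℕ) : ∀ m : ℕ, hr m * hr n = ∑ s ∈ Finset.range (n + 1),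
    ((s.factorial * m.choose s * n.choose s : ℕ) : Polynomial ℝ) * hr (m + n - 2 * s) := by
  induction n with
  | zero => intro m; simp [hr_zero]
  | succ n ih =>
    intro m
    have key : hr m * hr (n + 1) =
        (Polynomial.X * (hr m * hr n) - Polynomial.derivative (hr m * hr n))
          + (m : Polynomial ℝ) * (hr (m - 1) * hr n) := by
      rw [hr_succ n, Polynomial.derivative_mul, hr_deriv' m]; ring
    have hA : Polynomial.X * (hr m * hr n) - Polynomial.derivative (hr m * hr n) =
        ∑ s ∈ Finset.range (n + 1), ((s.factorial * m.choose s * n.choose s : ℕ) : Polynomial ℝ)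
          * hr (m + (n + 1) - 2 * s) := by
      rw [ih m, Polynomial.derivative_sum, Finset.mul_sum, ← Finset.sum_sub_distrib]
      refine Finset.sum_congr rfl fun s hs => ?_
      have hs' := Finset.mem_range.1 hs
      rcases lt_or_ge m s with h | h
      · simp [Nat.choose_eq_zero_of_lt h]
      · have : m + (n + 1) - 2 * s = (m + n - 2 * s) + 1 := by omega
        rw [this, hr_succ, Polynomial.derivative_mul, Polynomial.derivative_natCast]
        ring
    have hB : (m : Polynomial ℝ) * (hr (m - 1) * hr n) =
        ∑ s ∈ Finset.range (n + 1),
          (((s + 1).factorial * m.choose (s + 1) * n.choose s : ℕ) : Polynomial ℝ)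
          * hr (m + (n + 1) - 2 * (s + 1)) := by
      cases m with
      | zero => simp
      | succ m =>
        rw [ih, Finset.mul_sum]
        refine Finset.sum_congr rfl fun s hs => ?_
        have e : m + 1 + (n + 1) - 2 * (s + 1) = m + 1 - 1 + n - 2 * s := by omega
        rw [e, ← mul_assoc]
        congr 1
        norm_cast
        have := Nat.add_one_mul_choose_eq m s
        rw [Nat.factorial_succ, Nat.add_sub_cancel]
        calc _ = ((m + 1) * m.choose s) * (s.factorial * n.choose s) := by ring
          _ = _ := by rw [this]; ring
    rw [key, hA, hB, Finset.sum_range_succ' _ (n + 1)]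
    have hA2 : ∑ s ∈ Finset.range (n + 1), ((s.factorial * m.choose s * n.choose s : ℕ) : Polynomial ℝ)
          * hr (m + (n + 1) - 2 * s) = ∑ s ∈ Finset.range (n + 2), ((s.factorial * m.choose s * n.choose s : ℕ) : Polynomial ℝ)
          * hr (m + (n + 1) - 2 * s) := by
      rw [Finset.sum_range_succ _ (n + 1)]; simp
    rw [hA2, Finset.sum_range_succ' _ (n + 1), add_right_comm, ← Finset.sum_add_distrib]
    congr 1
    · refine Finset.sum_congr rfl fun s _ => ?_
      rw [← add_mul, Nat.choose_succ_succ n s]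
      congr 1
      push_cast
      ring
    · simp

lemma poly_int (p : Polynomial ℝ) :
    Integrable (fun z : ℝ => p.eval z * Real.exp (-z ^ 2 / 2)) := by
  induction p using Polynomial.induction_on' with
  | add p q hp hq =>
    simp only [Polynomial.eval_add, add_mul]
    exact hp.add hq
  | monomial k a =>
    have h := (integrable_rpow_mul_exp_neg_mul_sq (b := 1 / 2) (by norm_num) (s := (k : ℝ))
      (by have : (0 : ℝ) ≤ k := k.cast_nonneg
          linarith)).const_mul a
    refine h.congr (Filter.Eventually.of_forall fun z => ?_)
    simp only [Polynomial.eval_monomial, Real.rpow_natCast]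
    rw [mul_assoc]
    congr 3
    ring

/-- Unnormalised Gaussian expectation -/
noncomputable def GE (p : Polynomial ℝ) : ℝ := ∫ z : ℝ, p.eval z * Real.exp (-z ^ 2 / 2)

lemma GE_add (p q : Polynomial ℝ) : GE (p + q) = GE p + GE q := by
  simp only [GE, Polynomial.eval_add, add_mul]
  exact integral_add (poly_int p) (poly_int q)

lemma GE_C_mul (c : ℝ) (p : Polynomial ℝ) : GE (Polynomial.C c * p) = c * GE p := by
  simp only [GE, Polynomial.eval_mul, Polynomial.eval_C, mul_assoc]
  exact integral_const_mul _ _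

lemma GE_one : GE 1 = √(2 * π) := by
  have h := integral_gaussian (1 / 2)
  simp only [GE, Polynomial.eval_one, one_mul]
  convert h using 3
  · congr 1; ring
  · ring

lemma GE_stein (p : Polynomial ℝ) : GE (Polynomial.X * p) = GE (Polynomial.derivative p) := by
  have hd : ∀ z : ℝ, HasDerivAt (fun z : ℝ => p.eval z * Real.exp (-z ^ 2 / 2))
      ((Polynomial.derivative p + Polynomial.C (-1) * (Polynomial.X * p)).eval z
        * Real.exp (-z ^ 2 / 2)) z := by
    intro z
    have h1 : HasDerivAt (fun z : ℝ => -z ^ 2 / 2) (-z) z := by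
      refine ((hasDerivAt_pow 2 z).neg.div_const 2).congr_deriv ?_
      norm_num
      ring
    refine ((p.hasDerivAt z).mul h1.exp).congr_deriv ?_
    simp only [Polynomial.eval_add, Polynomial.eval_mul, Polynomial.eval_C, Polynomial.eval_X]
    ring
  have h0 : GE (Polynomial.derivative p + Polynomial.C (-1) * (Polynomial.X * p)) = 0 :=
    integral_eq_zero_of_hasDerivAt_of_integrable hd (poly_int _) (poly_int _)
  rw [GE_add, GE_C_mul] at h0
  linarith

lemma GE_hr (r q u : ℝ) (h : r ^ 2 + q ^ 2 = 1) (k : ℕ) :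
    GE ((hr k).comp (Polynomial.C (r * u) + Polynomial.C q * Polynomial.X))
      = √(2 * π) * (r ^ k * (hr k).eval u) := by
  set L : Polynomial ℝ := Polynomial.C (r * u) + Polynomial.C q * Polynomial.X with hL
  have step : ∀ k, GE ((hr (k + 1)).comp L) = r * u * GE ((hr k).comp L)
      - r ^ 2 * (k * GE ((hr (k - 1)).comp L)) := by
    intro k
    have e1 : (hr (k + 1)).comp L = Polynomial.C (r * u) * (hr k).comp L
        + (Polynomial.C q * (Polynomial.X * (hr k).comp L)
          + Polynomial.C (-(k : ℝ)) * (hr (k - 1)).comp L) := by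
      rw [hr_succ, hr_deriv']
      simp only [Polynomial.sub_comp, Polynomial.mul_comp, Polynomial.X_comp,
        Polynomial.natCast_comp, map_neg, map_natCast]
      rw [hL]
      ring
    have e2 : Polynomial.derivative ((hr k).comp L)
        = Polynomial.C (q * k) * (hr (k - 1)).comp L := by
      rw [Polynomial.derivative_comp, hr_deriv']
      simp only [Polynomial.mul_comp, Polynomial.natCast_comp]
      simp [hL]
      ring
    rw [e1, GE_add, GE_add, GE_C_mul, GE_C_mul, GE_C_mul, GE_stein, e2, GE_C_mul]
    have : q ^ 2 = 1 - r ^ 2 := by linarith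
    linear_combination (k * GE ((hr (k - 1)).comp L)) * this
  induction k using Nat.strong_induction_on with
  | _ k ih =>
    rcases k with _ | k
    · simp [hr_zero, GE_one]
    · rw [step, ih k (by omega), hr_succ, hr_deriv']
      rcases k with _ | k
      · simp [hr_zero]; ring
      · rw [Nat.add_sub_cancel, ih k (by omega)]
        simp
        ring

lemma integral_affine (f : ℝ → ℝ) (σ c : ℝ) (hσ : 0 < σ) :
    ∫ y, f y = σ * ∫ z, f (c + σ * z) := by
  have h := Measure.integral_comp_mul_left (fun y => f (c + y)) σ
  rw [h, integral_add_left_eq_self f c, abs_of_pos (inv_pos.2 hσ), smul_eq_mul]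
  field_simp

lemma GE_sum {ι : Type*} (s : Finset ι) (f : ι → Polynomial ℝ) :
    GE (∑ i ∈ s, f i) = ∑ i ∈ s, GE (f i) := by
  classical
  induction s using Finset.induction_on with
  | empty => simp [GE]
  | insert a s ha ih => rw [Finset.sum_insert ha, Finset.sum_insert ha, GE_add, ih]

theorem weierstrass_hermite_identity (α β γ : ℝ) (hα : 0 < α) (hβ : 0 < β) (hγ : 0 < γ)
    (habc : α ^ 2 = β ^ 2 + γ ^ 2) (m n : ℕ) (hnm : n ≤ m) (x : ℝ) :
    (Real.exp (-x ^ 2 / (2 * α ^ 2)) / (Real.sqrt (2 * π) * α)) *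
      ∑ s ∈ Finset.range (n + 1),
        (1 / (s.factorial : ℝ)) * ((m + n - 2 * s).choose (n - s) : ℝ) *
          (γ / α) ^ (m + n - 2 * s) * H (m + n - 2 * s) (x / α) / ((m + n - 2 * s).factorial : ℝ)
    = ∫ x' : ℝ,
        (Real.exp (-(x - x') ^ 2 / (2 * β ^ 2)) / (Real.sqrt (2 * π) * β)) *
        (Real.exp (-x' ^ 2 / (2 * γ ^ 2)) / (Real.sqrt (2 * π) * γ)) *
        (H m (x' / γ) / (m.factorial : ℝ)) * (H n (x' / γ) / (n.factorial : ℝ)) := by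
  have hα0 := hα.ne'
  have hβ0 := hβ.ne'
  have hγ0 := hγ.ne'
  have hrq : (γ / α) ^ 2 + (β / α) ^ 2 = 1 := by
    field_simp
    linarith
  have hS : √(2 * π) ≠ 0 := by positivity
  set L : Polynomial ℝ :=
    Polynomial.C (γ / α * (x / α)) + Polynomial.C (β / α) * Polynomial.X with hL
  have hR : (∫ x' : ℝ,
        (Real.exp (-(x - x') ^ 2 / (2 * β ^ 2)) / (Real.sqrt (2 * π) * β)) *
        (Real.exp (-x' ^ 2 / (2 * γ ^ 2)) / (Real.sqrt (2 * π) * γ)) *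
        (H m (x' / γ) / (m.factorial : ℝ)) * (H n (x' / γ) / (n.factorial : ℝ)))
      = Real.exp (-x ^ 2 / (2 * α ^ 2)) / (√(2 * π) * α) *
        (1 / √(2 * π) * (1 / (m.factorial * n.factorial : ℝ)) * GE ((hr m * hr n).comp L)) := by
    rw [integral_affine _ (β * γ / α) (γ ^ 2 / α ^ 2 * x) (by positivity), GE,
      ← integral_const_mul, ← integral_const_mul, ← integral_const_mul]
    refine integral_congr_ae (Filter.Eventually.of_forall fun z => ?_)
    have e1 : (γ ^ 2 / α ^ 2 * x + β * γ / α * z) / γ = L.eval z := by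
      simp only [hL, Polynomial.eval_add, Polynomial.eval_mul, Polynomial.eval_C, Polynomial.eval_X]
      field_simp
    have e2 : Real.exp (-(x - (γ ^ 2 / α ^ 2 * x + β * γ / α * z)) ^ 2 / (2 * β ^ 2)) *
        Real.exp (-(γ ^ 2 / α ^ 2 * x + β * γ / α * z) ^ 2 / (2 * γ ^ 2)) =
        Real.exp (-x ^ 2 / (2 * α ^ 2)) * Real.exp (-z ^ 2 / 2) := by
      rw [← Real.exp_add, ← Real.exp_add]
      congr 1
      have a1 : x - (γ ^ 2 / α ^ 2 * x + β * γ / α * z)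
          = β * (β / α * (x / α) - γ / α * z) := by
        have : x = (β ^ 2 + γ ^ 2) / α ^ 2 * x := by rw [← habc]; field_simp
        nth_rewrite 1 [this]
        field_simp
        ring
      have a2 : γ ^ 2 / α ^ 2 * x + β * γ / α * z = γ * (γ / α * (x / α) + β / α * z) := by
        field_simp
      rw [a1, a2]
      have a3 : -(β * (β / α * (x / α) - γ / α * z)) ^ 2 / (2 * β ^ 2) =
        -(β / α * (x / α) - γ / α * z) ^ 2 / 2 := by field_simp
      have a4 : -(γ * (γ / α * (x / α) + β / α * z)) ^ 2 / (2 * γ ^ 2) =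
        -(γ / α * (x / α) + β / α * z) ^ 2 / 2 := by field_simp
      have a5 : -x ^ 2 / (2 * α ^ 2) = - (x / α) ^ 2 / 2 := by field_simp
      rw [a3, a4, a5]
      linear_combination (-(x / α) ^ 2 / 2 - z ^ 2 / 2) * hrq
    simp only [H_eq, e1, Polynomial.eval_comp, Polynomial.eval_mul]
    generalize Polynomial.eval (Polynomial.eval z L) (hr m) = A
    generalize Polynomial.eval (Polynomial.eval z L) (hr n) = B
    have hm : (m.factorial : ℝ) ≠ 0 := by positivity
    have hn : (n.factorial : ℝ) ≠ 0 := by positivity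
    trans (β * γ / α) * ((1 / (√(2 * π) * β)) * (1 / (√(2 * π) * γ)) * (A / m.factorial) *
      (B / n.factorial)) * (Real.exp (-(x - (γ ^ 2 / α ^ 2 * x + β * γ / α * z)) ^ 2 / (2 * β ^ 2)) *
        Real.exp (-(γ ^ 2 / α ^ 2 * x + β * γ / α * z) ^ 2 / (2 * γ ^ 2)))
    · ring
    · rw [e2]
      generalize Real.exp (-x ^ 2 / (2 * α ^ 2)) = E1
      generalize Real.exp (-z ^ 2 / 2) = E2
      field_simp
  rw [hR, hr_mul]
  congr 1
  rw [Polynomial.sum_comp, GE_sum, Finset.mul_sum]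
  refine Finset.sum_congr rfl fun s hs => ?_
  have hs' : s ≤ n := Nat.lt_succ_iff.1 (Finset.mem_range.1 hs)
  rw [Polynomial.mul_comp, Polynomial.natCast_comp, ← map_natCast Polynomial.C, GE_C_mul,
    hL, GE_hr _ _ _ hrq, H_eq]
  obtain ⟨b, rfl⟩ := Nat.exists_eq_add_of_le hs'
  obtain ⟨a, rfl⟩ := Nat.exists_eq_add_of_le (hs'.trans hnm)
  have e : s + a + (s + b) - 2 * s = a + b := by omega
  rw [e, Nat.add_sub_cancel_left]
  push_cast
  have c1 : ((a + b).choose b : ℝ) = (a + b).factorial / (a.factorial * b.factorial) := by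
    rw [Nat.add_comm a b, Nat.cast_add_choose, mul_comm]
  rw [c1, Nat.cast_add_choose, Nat.cast_add_choose]
  have f1 : ∀ k : ℕ, (k.factorial : ℝ) ≠ 0 := fun k => by positivity
  have := f1 (a + b)
  have := f1 (s + a)
  have := f1 (s + b)
  have := f1 a
  have := f1 b
  have := f1 s
  generalize Polynomial.eval (x / α) (hr (a + b)) = A
  field_simp
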